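/- For every real ξ > 0 and every δ with 0 < δ < 1, there exist squarefree positive integers a and b with gcd(a, 2) = 1, gcd(b, 6) = 1, gcd(a, b) = 1, and 3 | a, such that (φ(a)/a)·(b/φ(b)) lies in the open interval (ξ(1−δ), ξ(1+δ)). -/

import Mathlib

/-- The product of the primes among `N + 1, …, N + n`. -/
def primeProd (N n : ℕ) : ℕ :=
  ∏ i ∈ Finset.range n, if (i + (N + 1)).Prime then i + (N + 1) else 1

theorem primeProd_succ (N n : ℕ) :
    primeProd N (n + 1) =
      primeProd N n * if (n + (N + 1)).Prime then n + (N + 1) else 1 :=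
  Finset.prod_range_succ _ _

theorem lt_and_lt_of_prime_dvd_primeProd {N n p : ℕ} (hp : p.Prime) (h : p ∣ primeProd N n) :
    N < p ∧ p < n + (N + 1) := by
  obtain ⟨i, hi, hd⟩ := (hp.prime.dvd_finsetProd_iff _).1 h
  rw [Finset.mem_range] at hi
  split_ifs at hd with hq
  · rw [Nat.prime_dvd_prime_iff_eq hp hq] at hd
    omega
  · exact absurd (Nat.dvd_one.1 hd) hp.ne_one

theorem primeProd_coprime_of_prime {N n : ℕ} (hq : (n + (N + 1)).Prime) :
    (primeProd N n).Coprime (n + (N + 1)) :=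
  ((Nat.Prime.coprime_iff_not_dvd hq).2 fun h =>
    lt_irrefl _ (lt_and_lt_of_prime_dvd_primeProd hq h).2).symm

theorem squarefree_primeProd (N n : ℕ) : Squarefree (primeProd N n) := by
  induction n with
  | zero => simp [primeProd]
  | succ n ih =>
    rw [primeProd_succ]
    split_ifs with hq
    · exact (Nat.squarefree_mul (primeProd_coprime_of_prime hq)).2 ⟨ih, hq.prime.squarefree⟩
    · simpa using ih

theorem div_totient_prime {p : ℕ} (hp : p.Prime) :
    (p : ℝ) / (p.totient : ℝ) = 1 + 1 / ((p : ℝ) - 1) := by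
  have h1 : (1 : ℝ) < p := by exact_mod_cast hp.one_lt
  rw [Nat.totient_prime hp, Nat.cast_pred hp.pos]
  have : (p : ℝ) - 1 ≠ 0 := by linarith
  field_simp
  ring

theorem div_totient_mul {m n : ℕ} (h : m.Coprime n) :
    ((m * n : ℕ) : ℝ) / ((m * n).totient : ℝ) =
      (m : ℝ) / (m.totient : ℝ) * ((n : ℝ) / (n.totient : ℝ)) := by
  rw [Nat.totient_mul h, Nat.cast_mul, Nat.cast_mul, mul_div_mul_comm]

theorem one_le_div_totient {n : ℕ} (hn : 0 < n) : 1 ≤ (n : ℝ) / (n.totient : ℝ) := by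
  rw [one_le_div (by exact_mod_cast Nat.totient_pos.2 hn)]
  exact_mod_cast Nat.totient_le n

theorem one_add_sum_le_div_totient_primeProd (N n : ℕ) :
    1 + ∑ i ∈ Finset.range n,
        Set.indicator {p : ℕ | p.Prime} (fun k : ℕ => (1 : ℝ) / k) (i + (N + 1)) ≤
      (primeProd N n : ℝ) / ((primeProd N n).totient : ℝ) := by
  induction n with
  | zero => simp [primeProd]
  | succ n ih =>
    have h1 := one_le_div_totient (Nat.pos_of_ne_zero (squarefree_primeProd N n).ne_zero)
    rw [Finset.sum_range_succ, primeProd_succ]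
    by_cases hq : (n + (N + 1)).Prime
    · rw [if_pos hq, div_totient_mul (primeProd_coprime_of_prime hq), div_totient_prime hq,
        Set.indicator_of_mem (by exact hq)]
      have hq1 : (0 : ℝ) < ((n + (N + 1) : ℕ) : ℝ) - 1 := by
        rw [sub_pos]
        exact_mod_cast hq.one_lt
      have h2 : 1 / ((n + (N + 1) : ℕ) : ℝ) ≤ 1 / (((n + (N + 1) : ℕ) : ℝ) - 1) :=
        one_div_le_one_div_of_le hq1 (by linarith)
      have h3 := le_mul_of_one_le_left (one_div_pos.2 hq1).le h1
      rw [mul_add, mul_one]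
      linarith
    · rw [if_neg hq, mul_one, Set.indicator_of_notMem (by exact hq), add_zero]
      exact ih

theorem exists_le_div_totient_primeProd (N : ℕ) (r : ℝ) :
    ∃ n, r ≤ (primeProd N n : ℝ) / ((primeProd N n).totient : ℝ) := by
  have hns := (summable_nat_add_iff (N + 1)).not.2 not_summable_one_div_on_primes
  have ht := (not_summable_iff_tendsto_nat_atTop_of_nonneg fun i =>
    Set.indicator_nonneg (fun k _ => by positivity) _).1 hns
  obtain ⟨n, hn⟩ := (ht.eventually_ge_atTop r).exists
  exact ⟨n, by linarith [one_add_sum_le_div_totient_primeProd N n]⟩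

/-- The values `b / φ(b)`, for squarefree `b` without small prime factors, approximate every real
number `r ≥ 1` from above. -/
theorem exists_squarefree_div_totient_mem_Ico (M : ℕ) {r η : ℝ} (hr : 1 ≤ r) (hη : 0 < η) :
    ∃ b : ℕ, Squarefree b ∧ (∀ p : ℕ, p.Prime → p ∣ b → M < p) ∧
      (b : ℝ) / (b.totient : ℝ) ∈ Set.Ico r (r * (1 + η)) := by
  obtain ⟨K, hK⟩ := exists_nat_gt (1 / η)
  let N := max M K
  have hKN : (K : ℝ) ≤ N := by exact_mod_cast le_max_right M K
  classical
  let n := Nat.find (exists_le_div_totient_primeProd N r)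
  have hn : r ≤ (primeProd N n : ℝ) / ((primeProd N n).totient : ℝ) :=
    Nat.find_spec (exists_le_div_totient_primeProd N r)
  have hmin : ∀ m < n, (primeProd N m : ℝ) / ((primeProd N m).totient : ℝ) < r := fun m hm =>
    not_le.1 (Nat.find_min (exists_le_div_totient_primeProd N r) hm)
  refine ⟨primeProd N n, squarefree_primeProd N n, fun p hp hd =>
    (le_max_left M K).trans_lt (lt_and_lt_of_prime_dvd_primeProd hp hd).1, hn, ?_⟩
  rcases hcase : n with _ | m
  · have : 1 < r * (1 + η) := by nlinarith
    simpa [primeProd] using this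
  · have hm := hmin m (by omega)
    rw [primeProd_succ]
    by_cases hq : (m + (N + 1)).Prime
    · rw [if_pos hq, div_totient_mul (primeProd_coprime_of_prime hq), div_totient_prime hq]
      have hlt : 1 / η < ((m + (N + 1) : ℕ) : ℝ) - 1 := by
        push_cast
        linarith [(Nat.cast_nonneg m : (0 : ℝ) ≤ m)]
      have hpos := (one_div_pos.2 hη).trans hlt
      have h2 := (one_div_lt hη hpos).1 hlt
      exact mul_lt_mul'' hm (by linarith) (by positivity) (by positivity)
    · rw [if_neg hq, mul_one]
      nlinarith

/-- For every `ξ > 0` and `0 < δ < 1` there are squarefree positive integers `a, b` with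
`gcd(a,2) = 1`, `gcd(b,6) = 1`, `gcd(a,b) = 1`, and `3 ∣ a`, such that
`(φ(a)/a)·(b/φ(b)) ∈ (ξ(1-δ), ξ(1+δ))`. -/
theorem totient_quotient_approx (ξ δ : ℝ) (hξ : 0 < ξ) (hδ₀ : 0 < δ) (hδ₁ : δ < 1) :
    ∃ a b : ℕ, 0 < a ∧ 0 < b ∧ Squarefree a ∧ Squarefree b ∧
      Nat.gcd a 2 = 1 ∧ Nat.gcd b 6 = 1 ∧ Nat.gcd a b = 1 ∧ 3 ∣ a ∧
      (Nat.totient a : ℝ) / (a : ℝ) * ((b : ℝ) / (Nat.totient b : ℝ)) ∈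
        Set.Ioo (ξ * (1 - δ)) (ξ * (1 + δ)) := by
  obtain ⟨c, hc, hcp, hcr, -⟩ :=
    exists_squarefree_div_totient_mem_Ico 3 (le_max_left 1 (1 / ξ)) one_pos
  have hc3 : Nat.Coprime 3 c := (Nat.Prime.coprime_iff_not_dvd Nat.prime_three).2 fun h =>
    lt_irrefl _ (hcp 3 Nat.prime_three h)
  have hc2 : Nat.Coprime 2 c := (Nat.Prime.coprime_iff_not_dvd Nat.prime_two).2 fun h =>
    absurd (hcp 2 Nat.prime_two h) (by norm_num)
  have hsq : Squarefree (3 * c) :=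
    (Nat.squarefree_mul hc3).2 ⟨Nat.prime_three.prime.squarefree, hc⟩
  have hpos : 0 < 3 * c := Nat.pos_of_ne_zero hsq.ne_zero
  have hr : 1 ≤ ξ * (((3 * c : ℕ) : ℝ) / ((3 * c).totient : ℝ)) := by
    have h1 := (le_max_right 1 (1 / ξ)).trans hcr
    have h3 : (1 : ℝ) ≤ ((3 : ℕ) : ℝ) / (Nat.totient 3 : ℝ) := one_le_div_totient (by norm_num)
    rw [div_totient_mul hc3, ← div_le_iff₀' hξ]
    exact h1.trans (le_mul_of_one_le_left ((one_div_pos.2 hξ).le.trans h1) h3)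
  obtain ⟨b, hb, hbp, hbl, hbu⟩ := exists_squarefree_div_totient_mem_Ico (3 * c) hr hδ₀
  have hab : Nat.Coprime (3 * c) b := Nat.Coprime.symm <| Nat.coprime_of_dvd fun p hp hpb hpa =>
    (hbp p hp hpb).not_ge (Nat.le_of_dvd hpos hpa)
  have hb6 : Nat.Coprime b (2 * 3) := by
    refine Nat.Coprime.mul_right ?_ hab.coprime_mul_right.symm
    refine ((Nat.Prime.coprime_iff_not_dvd Nat.prime_two).2 fun h => ?_).symm
    have := hbp 2 Nat.prime_two h
    omega
  refine ⟨3 * c, b, hpos, Nat.pos_of_ne_zero hb.ne_zero, hsq, hb,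
    Nat.Coprime.mul_left (by norm_num) hc2.symm, hb6, hab, dvd_mul_right 3 c, ?_⟩
  have hf : 0 < ((3 * c : ℕ) : ℝ) / ((3 * c).totient : ℝ) :=
    one_pos.trans_le (one_le_div_totient hpos)
  rw [← inv_div, ← div_eq_inv_mul, Set.mem_Ioo, lt_div_iff₀ hf, div_lt_iff₀ hf]
  constructor
  · refine lt_of_lt_of_le ?_ hbl
    exact mul_lt_mul_of_pos_right (by nlinarith) hf
  · rwa [mul_right_comm]
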